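/- There is an absolute constant C such that for every Borel probability measure p on [0,1]³ with coordinates (X,Y,Z): ψ(p) ≤ ψ̃(p) ≤ C·ψ(p), where ψ̃(p) = ∫ W2(p_{X,Y|Z=z}, p_{X|Z=z} × p_{Y|Z=z}) dp_Z(z) and ψ(p) = inf over pairs of Markov kernels z ↦ (q_{X|Z=z}, q_{Y|Z=z}) from [0,1] to Borel probability measures on [0,1] of ∫ W2(p_{X,Y|Z=z}, q_{X|Z=z} × q_{Y|Z=z}) dp_Z(z). -/

import Mathlib

open MeasureTheory

noncomputable section

/-- A coupling of `μ` and `ν`: a measure on the product whose marginals are `μ` and `ν`. -/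
def IsCoupling {α β : Type*} [MeasurableSpace α] [MeasurableSpace β]
    (γ : Measure (α × β)) (μ : Measure α) (ν : Measure β) : Prop :=
  γ.map Prod.fst = μ ∧ γ.map Prod.snd = ν

/-- The optimal transport cost between `μ` and `ν` for the cost function `cost`. -/
def transportCost {α β : Type*} [MeasurableSpace α] [MeasurableSpace β]
    (cost : α → β → ℝ) (μ : Measure α) (ν : Measure β) : ℝ :=
  sInf {c : ℝ | ∃ γ : Measure (α × β), IsProbabilityMeasure γ ∧ IsCoupling γ μ ν ∧
    c = ∫ z, cost z.1 z.2 ∂γ}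

/-- Euclidean distance on `ℝ²` (represented as `ℝ × ℝ`). -/
def eucDist (x y : ℝ × ℝ) : ℝ := Real.sqrt ((x.1 - y.1) ^ 2 + (x.2 - y.2) ^ 2)

/-- Wasserstein-1 distance on `ℝ²` with Euclidean cost. -/
def W1 (μ ν : Measure (ℝ × ℝ)) : ℝ := transportCost eucDist μ ν

/-- Wasserstein-2 distance on `ℝ²` with Euclidean cost. -/
def W2 (μ ν : Measure (ℝ × ℝ)) : ℝ :=
  Real.sqrt (transportCost (fun x y => (x.1 - y.1) ^ 2 + (x.2 - y.2) ^ 2) μ ν)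

/-- Wasserstein-1 distance on `ℝ` with cost `|x - y|`. -/
def W1R (μ ν : Measure ℝ) : ℝ := transportCost (fun x y => |x - y|) μ ν

/-- Wasserstein-2 distance on `ℝ` with cost `|x - y|`. -/
def W2R (μ ν : Measure ℝ) : ℝ :=
  Real.sqrt (transportCost (fun x y => (x - y) ^ 2) μ ν)

/-- The unit square `[0,1]² ⊆ ℝ²`. -/
def unitSq : Set (ℝ × ℝ) := Set.Icc 0 1 ×ˢ Set.Icc 0 1

/-- The unit interval `[0,1] ⊆ ℝ`. -/
def unitI : Set ℝ := Set.Icc 0 1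

/-- `κ` is a regular conditional distribution (a Markov kernel, supported on `[0,1]²`) of
`(X,Y)` given `Z = z`, for a probability measure `p` on `[0,1]³ ⊆ (ℝ × ℝ) × ℝ` whose first
coordinate is `(X,Y)` and second coordinate is `Z`. -/
def IsCondKernel (p : Measure ((ℝ × ℝ) × ℝ)) (κ : ℝ → Measure (ℝ × ℝ)) : Prop :=
  (∀ z, IsProbabilityMeasure (κ z)) ∧
  (∀ z ∈ unitI, κ z unitSq = 1) ∧
  (∀ A : Set (ℝ × ℝ), MeasurableSet A → Measurable fun z => κ z A) ∧
  (∀ A : Set (ℝ × ℝ), MeasurableSet A → ∀ B : Set ℝ, MeasurableSet B →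
    p (A ×ˢ B) = ∫⁻ z in B, κ z A ∂(p.map Prod.snd))

/-- The product of the two marginals of a measure on `ℝ²`. -/
def prodMargins (μ : Measure (ℝ × ℝ)) : Measure (ℝ × ℝ) :=
  (μ.map Prod.fst).prod (μ.map Prod.snd)

/-- The conditional distribution of `(X,Y)` given `Z ∈ C`, i.e. the normalized mixture
`A ↦ (1 / p_Z(C)) ∫_C κ_z(A) dp_Z(z)`. -/
def condBin (p : Measure ((ℝ × ℝ) × ℝ)) (κ : ℝ → Measure (ℝ × ℝ)) (C : Set ℝ) :
    Measure (ℝ × ℝ) :=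
  (p.map Prod.snd C)⁻¹ • ((p.map Prod.snd).restrict C).bind κ

/-- Wasserstein-1 Lipschitz smoothness of the conditional distributions:
`W1(p_{X,Y|Z=z}, p_{X,Y|Z=z'}) ≤ L·|z - z'|` for all `z, z' ∈ [0,1]`. -/
def WSmooth (L : ℝ) (κ : ℝ → Measure (ℝ × ℝ)) : Prop :=
  ∀ z ∈ unitI, ∀ z' ∈ unitI, W1 (κ z) (κ z') ≤ L * |z - z'|

/-- A Markov kernel from `[0,1]` to Borel probability measures on `[0,1]`. -/
def IsMarkovKernel01 (q : ℝ → Measure ℝ) : Prop :=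
  (∀ z, IsProbabilityMeasure (q z)) ∧
  (∀ z ∈ unitI, q z unitI = 1) ∧
  (∀ B : Set ℝ, MeasurableSet B → Measurable fun z => q z B)

/-- `ψ̃(p) = ∫ W2(p_{X,Y|Z=z}, p_{X|Z=z} × p_{Y|Z=z}) dp_Z(z)`. -/
def psiTilde (p : Measure ((ℝ × ℝ) × ℝ)) (κ : ℝ → Measure (ℝ × ℝ)) : ℝ :=
  ∫ z, W2 (κ z) (prodMargins (κ z)) ∂(p.map Prod.snd)

/-- `ψ(p)`: the infimum over pairs of Markov kernels `z ↦ (q_{X|Z=z}, q_{Y|Z=z})` of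
`∫ W2(p_{X,Y|Z=z}, q_{X|Z=z} × q_{Y|Z=z}) dp_Z(z)`. -/
def psiInf (p : Measure ((ℝ × ℝ) × ℝ)) (κ : ℝ → Measure (ℝ × ℝ)) : ℝ :=
  sInf {r : ℝ | ∃ qX qY : ℝ → Measure ℝ, IsMarkovKernel01 qX ∧ IsMarkovKernel01 qY ∧
    r = ∫ z, W2 (κ z) ((qX z).prod (qY z)) ∂(p.map Prod.snd)}

open ProbabilityTheory

abbrev qcost (x y : ℝ × ℝ) : ℝ := (x.1 - y.1) ^ 2 + (x.2 - y.2) ^ 2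

lemma ae_supp {γ : Measure ((ℝ × ℝ) × (ℝ × ℝ))} {μ ν : Measure (ℝ × ℝ)}
    [IsProbabilityMeasure μ] [IsProbabilityMeasure ν]
    (h : IsCoupling γ μ ν) (hμ : μ unitSq = 1) (hν : ν unitSq = 1) :
    ∀ᵐ w ∂γ, w ∈ unitSq ×ˢ unitSq := by
  have hm : MeasurableSet unitSq := measurableSet_Icc.prod measurableSet_Icc
  have h1 : ∀ᵐ x ∂μ, x ∈ unitSq := (mem_ae_iff_prob_eq_one hm).2 hμ
  have h2 : ∀ᵐ x ∂ν, x ∈ unitSq := (mem_ae_iff_prob_eq_one hm).2 hν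
  rw [← h.1] at h1
  rw [← h.2] at h2
  have h1' := ae_of_ae_map measurable_fst.aemeasurable h1
  have h2' := ae_of_ae_map measurable_snd.aemeasurable h2
  filter_upwards [h1', h2'] with w a b
  exact ⟨a, b⟩

lemma qcost_le {x y : ℝ × ℝ} (hx : x ∈ unitSq) (hy : y ∈ unitSq) : qcost x y ≤ 2 := by
  obtain ⟨⟨a, b⟩, c, d⟩ := hx
  obtain ⟨⟨e, f⟩, g, h⟩ := hy
  simp only [qcost]
  nlinarith

lemma qcost_nonneg (x y : ℝ × ℝ) : 0 ≤ qcost x y := by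
  simp only [qcost]; positivity

lemma integrable_bdd {α : Type*} [MeasurableSpace α] {m : Measure α} [IsProbabilityMeasure m]
    {f : α → ℝ} (hf : Measurable f) (h0 : ∀ x, 0 ≤ f x) (h : ∀ᵐ x ∂m, f x ≤ 2) :
    Integrable f m := by
  refine Integrable.of_bound hf.aestronglyMeasurable 2 ?_
  filter_upwards [h] with x hx
  rw [Real.norm_of_nonneg (h0 x)]
  exact hx

lemma integrable_qcost {γ : Measure ((ℝ × ℝ) × (ℝ × ℝ))} [IsProbabilityMeasure γ]
    {μ ν : Measure (ℝ × ℝ)} [IsProbabilityMeasure μ] [IsProbabilityMeasure ν]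
    (h : IsCoupling γ μ ν) (hμ : μ unitSq = 1) (hν : ν unitSq = 1) :
    Integrable (fun w => qcost w.1 w.2) γ := by
  refine integrable_bdd (by unfold qcost; fun_prop) (fun _ => qcost_nonneg _ _) ?_
  filter_upwards [ae_supp h hμ hν] with w hw
  exact qcost_le hw.1 hw.2

lemma tc_bdd (μ ν : Measure (ℝ × ℝ)) : BddBelow {c : ℝ | ∃ γ : Measure ((ℝ × ℝ) × (ℝ × ℝ)),
    IsProbabilityMeasure γ ∧ IsCoupling γ μ ν ∧ c = ∫ z, qcost z.1 z.2 ∂γ} := by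
  refine ⟨0, ?_⟩
  rintro c ⟨γ, _, _, rfl⟩
  exact integral_nonneg fun _ => qcost_nonneg _ _

lemma tc_nonempty (μ ν : Measure (ℝ × ℝ)) [IsProbabilityMeasure μ] [IsProbabilityMeasure ν] :
    {c : ℝ | ∃ γ : Measure ((ℝ × ℝ) × (ℝ × ℝ)),
    IsProbabilityMeasure γ ∧ IsCoupling γ μ ν ∧ c = ∫ z, qcost z.1 z.2 ∂γ}.Nonempty :=
  ⟨_, μ.prod ν, inferInstance, ⟨by simp, by simp⟩, rfl⟩

lemma glue {α β δ : Type*} [MeasurableSpace α] [MeasurableSpace β] [MeasurableSpace δ]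
    [StandardBorelSpace δ] [Nonempty δ]
    (γ : Measure (α × β)) (γ2 : Measure (β × δ)) [IsProbabilityMeasure γ] [IsProbabilityMeasure γ2]
    (h : γ.map Prod.snd = γ2.map Prod.fst) :
    ∃ π : Measure ((α × β) × δ), IsProbabilityMeasure π ∧ π.map Prod.fst = γ ∧
      π.map (fun w => (w.1.2, w.2)) = γ2 := by
  refine ⟨γ ⊗ₘ (γ2.condKernel.comap Prod.snd measurable_snd), inferInstance, ?_, ?_⟩
  · exact Measure.fst_compProd _ _
  · conv_rhs => rw [← γ2.disintegrate γ2.condKernel, Measure.fst, ← h]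
    refine Measure.ext_of_lintegral _ fun f hf => ?_
    have := (Measure.isProbabilityMeasure_map (μ := γ) (f := Prod.snd) (by fun_prop))
    rw [lintegral_map hf (by fun_prop), Measure.lintegral_compProd (by fun_prop),
      Measure.lintegral_compProd hf, lintegral_map (by fun_prop) (by fun_prop)]
    simp [Kernel.comap_apply]

set_option maxHeartbeats 1000000 in
lemma key {μ : Measure (ℝ × ℝ)} {a b : Measure ℝ} [IsProbabilityMeasure μ]
    [IsProbabilityMeasure a] [IsProbabilityMeasure b] (hμ : μ unitSq = 1)
    (ha : a unitI = 1) (hb : b unitI = 1) :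
    W2 μ (prodMargins μ) ≤ 2 * W2 μ (a.prod b) := by
  have hI : MeasurableSet unitI := measurableSet_Icc
  have hS : MeasurableSet unitSq := measurableSet_Icc.prod measurableSet_Icc
  have := (Measure.isProbabilityMeasure_map (μ := μ) (f := Prod.fst) (by fun_prop))
  have := (Measure.isProbabilityMeasure_map (μ := μ) (f := Prod.snd) (by fun_prop))
  have : IsProbabilityMeasure (prodMargins μ) := by unfold prodMargins; infer_instance
  have haS : a.prod b unitSq = 1 := by
    change a.prod b (unitI ×ˢ unitI) = 1
    rw [Measure.prod_prod, ha, hb, one_mul]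
  have hsup : ∀ᵐ x ∂μ, x ∈ unitSq := (mem_ae_iff_prob_eq_one hS).2 hμ
  have hmS : prodMargins μ unitSq = 1 := by
    change (μ.map Prod.fst).prod (μ.map Prod.snd) (unitI ×ˢ unitI) = 1
    have e1 : μ.map Prod.fst unitI = 1 := by
      refine (mem_ae_iff_prob_eq_one hI).1 ?_
      rw [mem_ae_map_iff (by fun_prop) hI]
      filter_upwards [hsup] with x hx using hx.1
    have e2 : μ.map Prod.snd unitI = 1 := by
      refine (mem_ae_iff_prob_eq_one hI).1 ?_
      rw [mem_ae_map_iff (by fun_prop) hI]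
      filter_upwards [hsup] with x hx using hx.2
    rw [Measure.prod_prod, e1, e2, one_mul]
  have main : transportCost qcost μ (prodMargins μ) ≤ 4 * transportCost qcost μ (a.prod b) := by
    rw [← div_le_iff₀' (by norm_num)]
    refine le_csInf (tc_nonempty _ _) ?_
    rintro c ⟨γ, hγ, hc, rfl⟩
    rw [div_le_iff₀' (by norm_num)]
    let gX := γ.map (fun w => (w.2.1, w.1.1))
    let gY := γ.map (fun w => (w.2.2, w.1.2))
    have pX : IsProbabilityMeasure gX := Measure.isProbabilityMeasure_map (by fun_prop)
    have pY : IsProbabilityMeasure gY := Measure.isProbabilityMeasure_map (by fun_prop)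
    let g2 := (gX.prod gY).map (fun w => ((w.1.1, w.2.1), (w.1.2, w.2.2)))
    have p2 : IsProbabilityMeasure g2 := Measure.isProbabilityMeasure_map (by fun_prop)
    have fX : gX.map Prod.fst = a := by
      have : a = (a.prod b).map Prod.fst := by simp
      rw [this, ← hc.2, Measure.map_map (by fun_prop) (by fun_prop),
        Measure.map_map (by fun_prop) (by fun_prop)]; rfl
    have fY : gY.map Prod.fst = b := by
      have : b = (a.prod b).map Prod.snd := by simp
      rw [this, ← hc.2, Measure.map_map (by fun_prop) (by fun_prop),
        Measure.map_map (by fun_prop) (by fun_prop)]; rfl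
    have sX : gX.map Prod.snd = μ.map Prod.fst := by
      rw [← hc.1, Measure.map_map (by fun_prop) (by fun_prop),
        Measure.map_map (by fun_prop) (by fun_prop)]; rfl
    have sY : gY.map Prod.snd = μ.map Prod.snd := by
      rw [← hc.1, Measure.map_map (by fun_prop) (by fun_prop),
        Measure.map_map (by fun_prop) (by fun_prop)]; rfl
    have c2 : IsCoupling g2 (a.prod b) (prodMargins μ) := by
      constructor
      · rw [← fX, ← fY, Measure.map_prod_map _ _ (by fun_prop) (by fun_prop),
          Measure.map_map (by fun_prop) (by fun_prop)]; rfl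
      · rw [prodMargins, ← sX, ← sY, Measure.map_prod_map _ _ (by fun_prop) (by fun_prop),
          Measure.map_map (by fun_prop) (by fun_prop)]; rfl
    have hs := ae_supp hc hμ haS
    have iX : Integrable (fun w : (ℝ × ℝ) × (ℝ × ℝ) => (w.1.1 - w.2.1) ^ 2) γ := by
      refine integrable_bdd (by fun_prop) (fun _ => sq_nonneg _) ?_
      filter_upwards [hs] with w hw
      have := qcost_le hw.1 hw.2
      simp only [qcost] at this
      nlinarith [sq_nonneg (w.1.2 - w.2.2)]
    have iY : Integrable (fun w : (ℝ × ℝ) × (ℝ × ℝ) => (w.1.2 - w.2.2) ^ 2) γ := by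
      refine integrable_bdd (by fun_prop) (fun _ => sq_nonneg _) ?_
      filter_upwards [hs] with w hw
      have := qcost_le hw.1 hw.2
      simp only [qcost] at this
      nlinarith [sq_nonneg (w.1.1 - w.2.1)]
    have jX : Integrable (fun w : ℝ × ℝ => (w.1 - w.2) ^ 2) gX := by
      refine (integrable_map_measure (Measurable.aestronglyMeasurable (by fun_prop))
        (by fun_prop)).2 ?_
      refine iX.congr (Filter.Eventually.of_forall fun w => ?_)
      simp only [Function.comp]; ring
    have jY : Integrable (fun w : ℝ × ℝ => (w.1 - w.2) ^ 2) gY := by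
      refine (integrable_map_measure (Measurable.aestronglyMeasurable (by fun_prop))
        (by fun_prop)).2 ?_
      refine iY.congr (Filter.Eventually.of_forall fun w => ?_)
      simp only [Function.comp]; ring
    have cost2 : ∫ w, qcost w.1 w.2 ∂g2 = ∫ w, qcost w.1 w.2 ∂γ := by
      have mq : Measurable (fun w : (ℝ × ℝ) × (ℝ × ℝ) => qcost w.1 w.2) := by
        unfold qcost; fun_prop
      rw [integral_map (by fun_prop) mq.aestronglyMeasurable]
      simp only [qcost]
      rw [integral_add (jX.comp_fst gY) (jY.comp_snd gX), integral_add iX iY]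
      rw [integral_fun_fst (μ := gX) (ν := gY) (fun w : ℝ × ℝ => (w.1 - w.2) ^ 2),
        integral_fun_snd (μ := gX) (ν := gY) (fun w : ℝ × ℝ => (w.1 - w.2) ^ 2)]
      simp only [probReal_univ, one_smul]
      rw [integral_map (by fun_prop) (Measurable.aestronglyMeasurable (by fun_prop)),
        integral_map (by fun_prop) (Measurable.aestronglyMeasurable (by fun_prop))]
      congr 1 <;> (congr 1; ext w; ring)
    obtain ⟨π, hπ, h1, h2⟩ := glue γ g2 (hc.2.trans c2.1.symm)
    have mq : Measurable (fun w : (ℝ × ℝ) × (ℝ × ℝ) => qcost w.1 w.2) := by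
      unfold qcost; fun_prop
    let g3 := π.map (fun w => (w.1.1, w.2))
    have p3 : IsProbabilityMeasure g3 := Measure.isProbabilityMeasure_map (by fun_prop)
    have c3 : IsCoupling g3 μ (prodMargins μ) := by
      constructor
      · rw [← hc.1, ← h1, Measure.map_map (by fun_prop) (by fun_prop),
          Measure.map_map (by fun_prop) (by fun_prop)]; rfl
      · rw [← c2.2, ← h2, Measure.map_map (by fun_prop) (by fun_prop),
          Measure.map_map (by fun_prop) (by fun_prop)]; rfl
    have i1 := integrable_qcost hc hμ haS
    have i2 := integrable_qcost c2 haS hmS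
    have i3 := integrable_qcost c3 hμ hmS
    have k1 : Integrable (fun w : ((ℝ × ℝ) × (ℝ × ℝ)) × (ℝ × ℝ) => qcost w.1.1 w.1.2) π := by
      have := i1
      rw [← h1] at this
      exact (integrable_map_measure mq.aestronglyMeasurable (by fun_prop)).1 this
    have k2 : Integrable (fun w : ((ℝ × ℝ) × (ℝ × ℝ)) × (ℝ × ℝ) => qcost w.1.2 w.2) π := by
      have := i2
      rw [← h2] at this
      exact (integrable_map_measure mq.aestronglyMeasurable (by fun_prop)).1 this
    have k3 : Integrable (fun w : ((ℝ × ℝ) × (ℝ × ℝ)) × (ℝ × ℝ) => qcost w.1.1 w.2) π :=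
      (integrable_map_measure mq.aestronglyMeasurable (by fun_prop)).1 i3
    have e1 : ∫ w, qcost w.1.1 w.1.2 ∂π = ∫ w, qcost w.1 w.2 ∂γ := by
      rw [← h1, integral_map (by fun_prop) mq.aestronglyMeasurable]
    have e2 : ∫ w, qcost w.1.2 w.2 ∂π = ∫ w, qcost w.1 w.2 ∂γ := by
      rw [← cost2, ← h2, integral_map (by fun_prop) mq.aestronglyMeasurable]
    have e3 : ∫ w, qcost w.1 w.2 ∂g3 = ∫ w, qcost w.1.1 w.2 ∂π := by
      rw [integral_map (by fun_prop) mq.aestronglyMeasurable]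
    calc transportCost qcost μ (prodMargins μ) ≤ ∫ w, qcost w.1 w.2 ∂g3 :=
          csInf_le (tc_bdd _ _) ⟨g3, p3, c3, rfl⟩
      _ = ∫ w, qcost w.1.1 w.2 ∂π := e3
      _ ≤ ∫ w, (2 * qcost w.1.1 w.1.2 + 2 * qcost w.1.2 w.2) ∂π := by
          refine integral_mono k3 ((k1.const_mul 2).add (k2.const_mul 2)) fun w => ?_
          simp only [qcost]
          nlinarith [sq_nonneg (w.1.1.1 - 2 * w.1.2.1 + w.2.1),
            sq_nonneg (w.1.1.2 - 2 * w.1.2.2 + w.2.2)]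
      _ = 4 * ∫ w, qcost w.1 w.2 ∂γ := by
          rw [integral_add (k1.const_mul 2) (k2.const_mul 2), integral_const_mul,
            integral_const_mul, e1, e2]; ring
  change Real.sqrt _ ≤ 2 * Real.sqrt _
  rw [show (2 : ℝ) = Real.sqrt 4 by rw [show (4 : ℝ) = 2 ^ 2 by norm_num]; simp,
    ← Real.sqrt_mul (by norm_num)]
  exact Real.sqrt_le_sqrt main

lemma isClosed_quad (i : ℚ × ℚ) :
    IsClosed (Set.Iic (i.1 : ℝ) ×ˢ Set.Iic (i.2 : ℝ)) := isClosed_Iic.prod isClosed_Iic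

/-- Countable family of separating test integrals. -/
def testInt (μ : Measure (ℝ × ℝ)) (i : (ℚ × ℚ) × ℕ) : ENNReal :=
  ∫⁻ x, ((isClosed_quad i.1).apprSeq i.2 x : ENNReal) ∂μ

lemma testInt_inj {μ ν : Measure (ℝ × ℝ)} [IsProbabilityMeasure μ] [IsProbabilityMeasure ν]
    (h : testInt μ = testInt ν) : μ = ν := by
  have hspan : IsCountablySpanning (⋃ a : ℚ, {Set.Iic (a : ℝ)}) := by
    refine ⟨fun n => Set.Iic (((n : ℕ) : ℚ) : ℝ), fun n => ?_, ?_⟩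
    · exact Set.mem_iUnion.2 ⟨(n : ℚ), rfl⟩
    · ext x
      simp only [Set.mem_iUnion, Set.mem_Iic, Set.mem_univ, iff_true]
      obtain ⟨n, hn⟩ := exists_nat_ge x
      exact ⟨n, by simpa using hn⟩
  have hb : MeasurableSpace.generateFrom (⋃ a : ℚ, {Set.Iic (a : ℝ)}) = Real.measurableSpace :=
    Real.borel_eq_generateFrom_Iic_rat.symm
  refine ext_of_generate_finite _
    (generateFrom_eq_prod hb hb hspan hspan).symm
    (Real.isPiSystem_Iic_rat.prod Real.isPiSystem_Iic_rat) ?_ (by simp)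
  rintro _ ⟨s, hs, t, ht, rfl⟩
  obtain ⟨a, rfl⟩ := Set.mem_iUnion.1 hs
  obtain ⟨b, rfl⟩ := Set.mem_iUnion.1 ht
  have h1 := HasOuterApproxClosed.tendsto_lintegral_apprSeq (isClosed_quad (a, b)) μ
  have h2 := HasOuterApproxClosed.tendsto_lintegral_apprSeq (isClosed_quad (a, b)) ν
  refine tendsto_nhds_unique h1 (h2.congr fun n => ?_)
  exact (congrFun h ((a, b), n)).symm

lemma measurable_testInt {κ : ℝ → Measure (ℝ × ℝ)} (hκ : Measurable κ) :
    Measurable (fun z => testInt (κ z)) := by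
  refine measurable_pi_iff.2 fun i => ?_
  exact (Measure.measurable_lintegral
    (by fun_prop)).comp hκ

lemma continuous_testInt : Continuous (fun μ : ProbabilityMeasure (ℝ × ℝ) =>
    testInt (μ : Measure (ℝ × ℝ))) :=
  continuous_pi fun _ => ProbabilityMeasure.continuous_lintegral_boundedContinuousFunction _

/-- truncated cost -/
def tcost : BoundedContinuousFunction ((ℝ × ℝ) × (ℝ × ℝ)) ℝ :=
  BoundedContinuousFunction.ofNormedAddCommGroup (fun w => min (qcost w.1 w.2) 2)
    (by unfold qcost; fun_prop) 2 (fun w => by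
      rw [Real.norm_of_nonneg (le_min (qcost_nonneg _ _) (by norm_num))]
      exact min_le_right _ _)

/-- admissible plans of cost at most `r` -/
def plans (r : ℝ) : Set (ProbabilityMeasure ((ℝ × ℝ) × (ℝ × ℝ))) :=
  {γ | ∀ _ : ℕ, γ (unitSq ×ˢ unitSq)ᶜ ≤ 0} ∩ {γ | ∫ w, tcost w ∂(γ : Measure ((ℝ × ℝ) × (ℝ × ℝ))) ≤ r}

lemma isCompact_plans (r : ℝ) : IsCompact (plans r) := by
  have hS : IsCompact unitSq := isCompact_Icc.prod isCompact_Icc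
  refine IsCompact.inter_right ?_ ?_
  · exact isCompact_setOfPred_probabilityMeasure_mass_eq_compl_isCompact_le
      (u := fun _ => 0) (K := fun _ => unitSq ×ˢ unitSq) tendsto_const_nhds
      (fun _ => hS.prod hS) (Or.inl inferInstance)
  · exact isClosed_le (ProbabilityMeasure.continuous_integral_boundedContinuousFunction tcost)
      continuous_const

/-- test integrals of the marginals -/
def margTest (γ : ProbabilityMeasure ((ℝ × ℝ) × (ℝ × ℝ))) :
    ((ℚ × ℚ) × ℕ → ENNReal) × ((ℚ × ℚ) × ℕ → ENNReal) :=
  (testInt ((γ : Measure ((ℝ × ℝ) × (ℝ × ℝ))).map Prod.fst), testInt ((γ : Measure ((ℝ × ℝ) × (ℝ × ℝ))).map Prod.snd))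

lemma continuous_margTest : Continuous margTest :=
  (continuous_testInt.comp (ProbabilityMeasure.continuous_map continuous_fst)).prodMk
    (continuous_testInt.comp (ProbabilityMeasure.continuous_map continuous_snd))

lemma tc_lt_iff {μ ν : Measure (ℝ × ℝ)} [IsProbabilityMeasure μ] [IsProbabilityMeasure ν]
    (hμ : μ unitSq = 1) (hν : ν unitSq = 1) (c : ℝ) :
    transportCost qcost μ ν < c ↔
      ∃ r : ℚ, (r : ℝ) < c ∧ (testInt μ, testInt ν) ∈ margTest '' plans r := by
  have hS : MeasurableSet (unitSq ×ˢ unitSq) :=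
    (measurableSet_Icc.prod measurableSet_Icc).prod (measurableSet_Icc.prod measurableSet_Icc)
  have hcost : ∀ γ : Measure ((ℝ × ℝ) × (ℝ × ℝ)), IsCoupling γ μ ν →
      ∫ w, tcost w ∂γ = ∫ w, qcost w.1 w.2 ∂γ := fun γ hγ => by
    refine integral_congr_ae ?_
    filter_upwards [ae_supp hγ hμ hν] with w hw
    exact min_eq_left (qcost_le hw.1 hw.2)
  constructor
  · intro h
    obtain ⟨_, ⟨γ, hγ, hc, rfl⟩, hlt⟩ := exists_lt_of_csInf_lt (tc_nonempty μ ν) h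
    obtain ⟨r, hr1, hr2⟩ := exists_rat_btwn hlt
    let G : ProbabilityMeasure ((ℝ × ℝ) × (ℝ × ℝ)) := ⟨γ, hγ⟩
    refine ⟨r, hr2, G, ⟨fun _ => ?_, ?_⟩, ?_⟩
    · have : γ (unitSq ×ˢ unitSq)ᶜ = 0 := ae_supp hc hμ hν
      rw [← ENNReal.coe_le_coe, ProbabilityMeasure.ennreal_coeFn_eq_coeFn_toMeasure]
      exact this.le
    · change ∫ w, tcost w ∂γ ≤ r
      rw [hcost γ hc]
      exact hr1.le
    · change (testInt (γ.map Prod.fst), testInt (γ.map Prod.snd)) = _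
      rw [hc.1, hc.2]
  · rintro ⟨r, hr, γ, ⟨_, h2⟩, h3⟩
    have p1 := (Measure.isProbabilityMeasure_map (μ := (γ : Measure ((ℝ × ℝ) × (ℝ × ℝ)))) (f := Prod.fst)
      (by fun_prop))
    have p2 := (Measure.isProbabilityMeasure_map (μ := (γ : Measure ((ℝ × ℝ) × (ℝ × ℝ)))) (f := Prod.snd)
      (by fun_prop))
    have hc : IsCoupling (γ : Measure ((ℝ × ℝ) × (ℝ × ℝ))) μ ν :=
      ⟨testInt_inj (congrArg Prod.fst h3), testInt_inj (congrArg Prod.snd h3)⟩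
    refine lt_of_le_of_lt ?_ hr
    refine le_trans ?_ (show ∫ w, tcost w ∂(γ : Measure ((ℝ × ℝ) × (ℝ × ℝ))) ≤ r from h2)
    rw [hcost _ hc]
    exact csInf_le (tc_bdd _ _) ⟨γ, inferInstance, hc, rfl⟩

lemma measurable_W2 {κ ν : ℝ → Measure (ℝ × ℝ)} (hκ : Measurable κ) (hν : Measurable ν)
    (pκ : ∀ z, IsProbabilityMeasure (κ z)) (pν : ∀ z, IsProbabilityMeasure (ν z))
    (sκ : ∀ z, κ z unitSq = 1) (sν : ∀ z, ν z unitSq = 1) :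
    Measurable fun z => W2 (κ z) (ν z) := by
  refine Real.continuous_sqrt.measurable.comp ?_
  refine measurable_of_Iio fun c => ?_
  have : (fun z => transportCost qcost (κ z) (ν z)) ⁻¹' Set.Iio c =
      ⋃ r : ℚ, ⋃ _ : (r : ℝ) < c,
        (fun z => (testInt (κ z), testInt (ν z))) ⁻¹' (margTest '' plans r) := by
    ext z
    simp only [Set.mem_preimage, Set.mem_Iio, Set.mem_iUnion, exists_prop]
    exact tc_lt_iff (sκ z) (sν z) c
  change MeasurableSet ((fun z => transportCost qcost (κ z) (ν z)) ⁻¹' Set.Iio c)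
  rw [this]
  refine MeasurableSet.iUnion fun r => MeasurableSet.iUnion fun _ => ?_
  exact ((measurable_testInt hκ).prodMk (measurable_testInt hν))
    ((isCompact_plans r).image continuous_margTest).measurableSet

lemma W2_nonneg (μ ν : Measure (ℝ × ℝ)) : 0 ≤ W2 μ ν := Real.sqrt_nonneg _

lemma W2_le {μ ν : Measure (ℝ × ℝ)} [IsProbabilityMeasure μ] [IsProbabilityMeasure ν]
    (hμ : μ unitSq = 1) (hν : ν unitSq = 1) : W2 μ ν ≤ 2 := by
  have hc : IsCoupling (μ.prod ν) μ ν := ⟨by simp, by simp⟩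
  have h1 : transportCost qcost μ ν ≤ ∫ w, qcost w.1 w.2 ∂(μ.prod ν) :=
    csInf_le (tc_bdd _ _) ⟨μ.prod ν, inferInstance, hc, rfl⟩
  have h2 : ∫ w, qcost w.1 w.2 ∂(μ.prod ν) ≤ ∫ _, (2 : ℝ) ∂(μ.prod ν) := by
    refine integral_mono_ae (integrable_qcost hc hμ hν) (integrable_const _) ?_
    filter_upwards [ae_supp hc hμ hν] with w hw
    exact qcost_le hw.1 hw.2
  have h3 : transportCost qcost μ ν ≤ 2 ^ 2 := by
    simp only [integral_const, probReal_univ, one_smul] at h2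
    linarith
  exact Real.sqrt_le_iff.2 ⟨by norm_num, h3⟩

lemma prod_supp {a b : Measure ℝ} [IsProbabilityMeasure a] [IsProbabilityMeasure b]
    (ha : a unitI = 1) (hb : b unitI = 1) : a.prod b unitSq = 1 := by
  change a.prod b (unitI ×ˢ unitI) = 1
  rw [Measure.prod_prod, ha, hb, one_mul]

lemma integrable_W2 {m : Measure ℝ} [IsProbabilityMeasure m] (hm : ∀ᵐ z ∂m, z ∈ unitI)
    {κ : ℝ → Measure (ℝ × ℝ)} {a b : ℝ → Measure ℝ} (hκ : Measurable κ)
    (pκ : ∀ z, IsProbabilityMeasure (κ z)) (sκ : ∀ z ∈ unitI, κ z unitSq = 1)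
    (ha : IsMarkovKernel01 a) (hb : IsMarkovKernel01 b) :
    Integrable (fun z => W2 (κ z) ((a z).prod (b z))) m := by
  classical
  have pa := ha.1
  have pb := hb.1
  have hI : MeasurableSet unitI := measurableSet_Icc
  have mab : Measurable (fun z => (a z).prod (b z)) := by
    let A : Kernel ℝ ℝ := ⟨a, Measure.measurable_of_measurable_coe _ ha.2.2⟩
    let B : Kernel ℝ ℝ := ⟨b, Measure.measurable_of_measurable_coe _ hb.2.2⟩
    have : IsMarkovKernel A := ⟨pa⟩
    have : IsMarkovKernel B := ⟨pb⟩
    have h := (A ×ₖ B).measurable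
    convert h using 2 with z
    rw [Kernel.prod_apply]; rfl
  let d : Measure (ℝ × ℝ) := Measure.dirac 0
  have sd : d unitSq = 1 := by
    refine Measure.dirac_apply_of_mem ?_
    exact ⟨⟨le_rfl, zero_le_one⟩, ⟨le_rfl, zero_le_one⟩⟩
  let κ' : ℝ → Measure (ℝ × ℝ) := fun z => if z ∈ unitI then κ z else d
  let ν' : ℝ → Measure (ℝ × ℝ) := fun z => if z ∈ unitI then (a z).prod (b z) else d
  have M : Measurable fun z => W2 (κ' z) (ν' z) := by
    refine measurable_W2 (Measurable.ite hI hκ measurable_const)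
      (Measurable.ite hI mab measurable_const) ?_ ?_ ?_ ?_ <;> intro z <;> by_cases hz : z ∈ unitI
    · simp only [κ', hz, if_true]; exact pκ z
    · simp only [κ', hz, if_false]; infer_instance
    · simp only [ν', hz, if_true]; infer_instance
    · simp only [ν', hz, if_false]; infer_instance
    · simp only [κ', hz, if_true]; exact sκ z hz
    · simp only [κ', hz, if_false]; exact sd
    · simp only [ν', hz, if_true]; exact prod_supp (ha.2.1 z hz) (hb.2.1 z hz)
    · simp only [ν', hz, if_false]; exact sd
  have E : ∀ᵐ z ∂m, W2 (κ' z) (ν' z) = W2 (κ z) ((a z).prod (b z)) := by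
    filter_upwards [hm] with z hz
    simp only [κ', ν', hz, if_true]
  refine Integrable.congr ?_ E
  refine integrable_bdd M (fun _ => W2_nonneg _ _) ?_
  filter_upwards [E, hm] with z hz hzI
  rw [hz]
  exact W2_le (sκ z hzI) (prod_supp (ha.2.1 z hzI) (hb.2.1 z hzI))

/-- There is an absolute constant `C` such that for every Borel probability
measure `p` on `[0,1]³` with regular conditional distribution `κ`:
`ψ(p) ≤ ψ̃(p) ≤ C·ψ(p)`. -/
theorem psiInf_le_psiTilde_le :
    ∃ C : ℝ, 0 < C ∧
      ∀ p : Measure ((ℝ × ℝ) × ℝ), IsProbabilityMeasure p → p (unitSq ×ˢ unitI) = 1 →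
        ∀ κ : ℝ → Measure (ℝ × ℝ), IsCondKernel p κ →
          psiInf p κ ≤ psiTilde p κ ∧ psiTilde p κ ≤ C * psiInf p κ := by
  refine ⟨2, by norm_num, fun p hp hp1 κ ⟨pκ, sκ, mκ, _⟩ => ?_⟩
  have hκ : Measurable κ := Measure.measurable_of_measurable_coe _ mκ
  have hI : MeasurableSet unitI := measurableSet_Icc
  have hS : MeasurableSet unitSq := measurableSet_Icc.prod measurableSet_Icc
  have pm : IsProbabilityMeasure (p.map Prod.snd) :=
    Measure.isProbabilityMeasure_map (by fun_prop)
  have hm : ∀ᵐ z ∂(p.map Prod.snd), z ∈ unitI := by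
    refine (mem_ae_map_iff (by fun_prop) hI).2 ?_
    have : ∀ᵐ w ∂p, w ∈ unitSq ×ˢ unitI := (mem_ae_iff_prob_eq_one (hS.prod hI)).2 hp1
    filter_upwards [this] with w hw using hw.2
  have mX : IsMarkovKernel01 (fun z => (κ z).map Prod.fst) := by
    refine ⟨fun z => Measure.isProbabilityMeasure_map (by fun_prop), fun z hz => ?_, fun B hB => ?_⟩
    · have := pκ z
      have h := Measure.isProbabilityMeasure_map (μ := κ z) (f := Prod.fst) (by fun_prop)
      refine (mem_ae_iff_prob_eq_one hI).1 ((mem_ae_map_iff (by fun_prop) hI).2 ?_)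
      have : ∀ᵐ w ∂(κ z), w ∈ unitSq := (mem_ae_iff_prob_eq_one hS).2 (sκ z hz)
      filter_upwards [this] with w hw using hw.1
    · simp_rw [Measure.map_apply measurable_fst hB]
      exact mκ _ (measurable_fst hB)
  have mY : IsMarkovKernel01 (fun z => (κ z).map Prod.snd) := by
    refine ⟨fun z => Measure.isProbabilityMeasure_map (by fun_prop), fun z hz => ?_, fun B hB => ?_⟩
    · have := pκ z
      have h := Measure.isProbabilityMeasure_map (μ := κ z) (f := Prod.snd) (by fun_prop)
      refine (mem_ae_iff_prob_eq_one hI).1 ((mem_ae_map_iff (by fun_prop) hI).2 ?_)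
      have : ∀ᵐ w ∂(κ z), w ∈ unitSq := (mem_ae_iff_prob_eq_one hS).2 (sκ z hz)
      filter_upwards [this] with w hw using hw.2
    · simp_rw [Measure.map_apply measurable_snd hB]
      exact mκ _ (measurable_snd hB)
  constructor
  · refine csInf_le ⟨0, ?_⟩ ⟨_, _, mX, mY, rfl⟩
    rintro r ⟨a, b, _, _, rfl⟩
    exact integral_nonneg fun _ => W2_nonneg _ _
  · rw [← div_le_iff₀' (by norm_num)]
    refine le_csInf ⟨_, _, _, mX, mY, rfl⟩ ?_
    rintro r ⟨a, b, ha, hb, rfl⟩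
    rw [div_le_iff₀' (by norm_num), psiTilde, ← integral_const_mul]
    refine integral_mono_of_nonneg (Filter.Eventually.of_forall fun _ => W2_nonneg _ _)
      ((integrable_W2 hm hκ pκ sκ ha hb).const_mul 2) ?_
    filter_upwards [hm] with z hz
    have := pκ z
    have := ha.1 z
    have := hb.1 z
    exact key (sκ z hz) (ha.2.1 z hz) (hb.2.1 z hz)

end
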